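/- Failure of monotonicity of the information functional in dimension n ≥ 3: there exist compact convex sets A, T ⊂ ℝⁿ with nonempty interior such that I(A+T) < I(A), where I(K) = vol_n(K)/vol_{n−1}(∂K). Concretely, for T = [0, eₙ] and A = (Q + M[0,eₙ]) \ D, where Q = Σ_{i=1}^{n−1}[0,e_i] is the unit (n−1)-cube, D is the simplex with vertices 0, εe₁, …, εe_{n−1}, Meₙ, and ε, M are chosen with 1/(M(n−1)) + ε^{n−1}/n! < (ε^{n−2}/(2(n−1)!))(1 − √n/(n−1)), one has I(A) > I(A|_{eₙ}), violating the projection inequality equivalent to monotonicity. -/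

import Mathlib

open MeasureTheory Pointwise

/-- The information functional `I(K) = vol_n(K) / vol_{n-1}(∂K)`:
volume divided by the surface area (the `(n-1)`-dimensional Hausdorff
measure of the topological boundary). -/
noncomputable def info (n : ℕ) (K : Set (EuclideanSpace ℝ (Fin n))) : ℝ :=
  (volume K).toReal / (μH[(n : ℝ) - 1] (frontier K)).toReal

/-- The coordinate box `∏ᵢ [0, ℓ i]`. -/
def coordBox {m : ℕ} (l : Fin m → ℝ) : Set (EuclideanSpace ℝ (Fin m)) :=
  {x | ∀ i, x i ∈ Set.Icc 0 (l i)}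

/-- The embedding of `ℝᵐ` into `ℝᵐ⁺¹` as the hyperplane `x i = a`. -/
noncomputable def hyperplaneEmb {m : ℕ} (i : Fin (m + 1)) (a : ℝ)
    (y : EuclideanSpace ℝ (Fin m)) : EuclideanSpace ℝ (Fin (m + 1)) :=
  WithLp.toLp 2 (i.insertNth a y.ofLp)

theorem hyperplaneEmb_same {m : ℕ} (i : Fin (m + 1)) (a : ℝ) (y : EuclideanSpace ℝ (Fin m)) :
    hyperplaneEmb i a y i = a := by
  simp [hyperplaneEmb]

theorem hyperplaneEmb_succAbove {m : ℕ} (i : Fin (m + 1)) (a : ℝ)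
    (y : EuclideanSpace ℝ (Fin m)) (j : Fin m) :
    hyperplaneEmb i a y (i.succAbove j) = y j := by
  simp [hyperplaneEmb]

theorem exists_hyperplaneEmb_eq {m : ℕ} (i : Fin (m + 1)) (x : EuclideanSpace ℝ (Fin (m + 1))) :
    ∃ y, hyperplaneEmb i (x i) y = x ∧ ∀ j, y j = x (i.succAbove j) := by
  refine ⟨WithLp.toLp 2 (fun j => x (i.succAbove j)), ?_, fun j => rfl⟩
  ext j
  refine Fin.succAboveCases i ?_ (fun j => ?_) j
  · exact hyperplaneEmb_same _ _ _
  · exact hyperplaneEmb_succAbove _ _ _ _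

theorem isometry_hyperplaneEmb {m : ℕ} (i : Fin (m + 1)) (a : ℝ) :
    Isometry (hyperplaneEmb i a) := by
  refine Isometry.of_dist_eq fun x y => ?_
  rw [EuclideanSpace.dist_eq, EuclideanSpace.dist_eq, Fin.sum_univ_succAbove _ i]
  simp [hyperplaneEmb]

/-- On Euclidean space the Hausdorff measure is a positive multiple of Lebesgue measure. -/
theorem exists_hausdorffMeasure_eq_mul_volume (m : ℕ) :
    ∃ c : ℝ, 0 < c ∧ ∀ s : Set (EuclideanSpace ℝ (Fin m)),
      μH[(m : ℝ)] s = ENNReal.ofReal c * volume s := by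
  refine ⟨((μH[(m : ℝ)] : Measure (EuclideanSpace ℝ (Fin m))).addHaarScalarFactor volume : NNReal),
    ?_, fun s => ?_⟩
  · exact_mod_cast Measure.addHaarScalarFactor_pos_of_isAddHaarMeasure _ _
  · conv_lhs => rw [Measure.isAddLeftInvariant_eq_smul
      (μH[(m : ℝ)] : Measure (EuclideanSpace ℝ (Fin m))) volume]
    rw [Measure.smul_apply, ENNReal.ofReal_coe_nnreal]
    rfl

theorem volume_coordBox {m : ℕ} {l : Fin m → ℝ} (hl : ∀ i, 0 ≤ l i) :
    volume (coordBox l) = ENNReal.ofReal (∏ i, l i) := by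
  have h : coordBox l = WithLp.ofLp ⁻¹' (Set.Icc (0 : Fin m → ℝ) l) := by
    ext x
    simp [coordBox, Pi.le_def, forall_and]
  rw [h, (PiLp.volume_preserving_ofLp (Fin m)).measure_preimage
    measurableSet_Icc.nullMeasurableSet, Real.volume_Icc_pi,
    ENNReal.ofReal_prod_of_nonneg fun i _ => hl i]
  simp

theorem isCompact_coordBox {m : ℕ} (l : Fin m → ℝ) : IsCompact (coordBox l) := by
  have h : coordBox l = WithLp.toLp 2 '' (Set.Icc (0 : Fin m → ℝ) l) := by
    ext x
    constructor
    · intro hx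
      exact ⟨x.ofLp, ⟨fun i => (hx i).1, fun i => (hx i).2⟩, rfl⟩
    · rintro ⟨y, hy, rfl⟩ i
      exact ⟨hy.1 i, hy.2 i⟩
  rw [h]
  exact isCompact_Icc.image (PiLp.continuous_toLp 2 _)

theorem convex_coordBox {m : ℕ} (l : Fin m → ℝ) : Convex ℝ (coordBox l) := by
  intro x hx y hy a b ha hb hab i
  exact convex_Icc 0 (l i) (hx i) (hy i) ha hb hab

theorem isOpen_setOf_forall_mem_Ioo {m : ℕ} (a b : Fin m → ℝ) :
    IsOpen {x : EuclideanSpace ℝ (Fin m) | ∀ i, x i ∈ Set.Ioo (a i) (b i)} := by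
  simp only [Set.ofPred_forall]
  exact isOpen_iInter_of_finite fun i => isOpen_Ioo.preimage (by fun_prop)

theorem volume_setOf_forall_mem_Ioo {m : ℕ} {a b : Fin m → ℝ} (h : ∀ i, a i ≤ b i) :
    volume {x : EuclideanSpace ℝ (Fin m) | ∀ i, x i ∈ Set.Ioo (a i) (b i)} =
      ENNReal.ofReal (∏ i, (b i - a i)) := by
  have h' : {x : EuclideanSpace ℝ (Fin m) | ∀ i, x i ∈ Set.Ioo (a i) (b i)} =
      WithLp.ofLp ⁻¹' (Set.univ.pi fun i => Set.Ioo (a i) (b i)) := by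
    ext x
    simp
  rw [h', (PiLp.volume_preserving_ofLp (Fin m)).measure_preimage
    (MeasurableSet.univ_pi fun i => measurableSet_Ioo).nullMeasurableSet, Real.volume_pi_Ioo,
    ENNReal.ofReal_prod_of_nonneg fun i _ => sub_nonneg.2 (h i)]

/-- The side lengths of the box `[0, a] × [0, b] × [0, 1]ᵏ`. -/
def twoSides {k : ℕ} (a b : ℝ) : Fin (k + 2) → ℝ :=
  Fin.cons a (Fin.cons b fun _ => 1)

theorem twoSides_nonneg {k : ℕ} {a b : ℝ} (ha : 0 ≤ a) (hb : 0 ≤ b) (i : Fin (k + 2)) :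
    0 ≤ twoSides a b i := by
  refine Fin.cases ha (fun i => ?_) i
  refine Fin.cases hb (fun i => ?_) i
  exact zero_le_one

theorem volume_coordBox_twoSides {k : ℕ} {a b : ℝ} (ha : 0 ≤ a) (hb : 0 ≤ b) :
    volume (coordBox (twoSides a b : Fin (k + 2) → ℝ)) = ENNReal.ofReal (a * b) := by
  rw [volume_coordBox (twoSides_nonneg ha hb)]
  simp [twoSides, Fin.prod_univ_succ]

/-- A closed right triangular prism with legs `a`, `b` has at least half the volume of its box. -/
theorem le_volume_prism {k : ℕ} {a b : ℝ} (ha : 0 < a) (hb : 0 < b) :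
    ENNReal.ofReal (a * b / 2) ≤
      volume {y ∈ coordBox (twoSides a b : Fin (k + 2) → ℝ) | y 0 / a + y 1 / b ≤ 1} := by
  set P := {y ∈ coordBox (twoSides a b : Fin (k + 2) → ℝ) | y 0 / a + y 1 / b ≤ 1}
  set v : EuclideanSpace ℝ (Fin (k + 2)) := WithLp.toLp 2 (twoSides a b)
  have hmp := Measure.measurePreserving_sub_left
    (volume : Measure (EuclideanSpace ℝ (Fin (k + 2)))) v
  have hP : MeasurableSet P := by
    have h : IsClosed {y : EuclideanSpace ℝ (Fin (k + 2)) | y 0 / a + y 1 / b ≤ 1} :=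
      isClosed_le (by fun_prop) (by fun_prop)
    exact (isCompact_coordBox _).measurableSet.inter h.measurableSet
  have hcov : coordBox (twoSides a b) ⊆ P ∪ (fun y => v - y) ⁻¹' P := by
    intro y hy
    by_cases h : y 0 / a + y 1 / b ≤ 1
    · exact Or.inl ⟨hy, h⟩
    · refine Or.inr ⟨fun i => ?_, ?_⟩
      · have := hy i
        simp only [Set.mem_Icc] at this
        simp only [Set.mem_Icc, PiLp.sub_apply, v]
        constructor <;> linarith
      · have h0 : (v - y) 0 = a - y 0 := rfl
        have h1 : (v - y) 1 = b - y 1 := rfl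
        rw [h0, h1, sub_div, sub_div, div_self ha.ne', div_self hb.ne']
        linarith
  have h := (measure_mono hcov).trans (measure_union_le (μ := volume) _ _)
  rw [volume_coordBox_twoSides ha.le hb.le, hmp.measure_preimage hP.nullMeasurableSet,
    ← two_mul] at h
  rw [ENNReal.ofReal_div_of_pos two_pos]
  refine ENNReal.div_le_of_le_mul' ?_
  simpa using h

/-- An open right triangular prism with legs `a`, `b` has at most half the volume of its box. -/
theorem volume_prism_le {k : ℕ} {a b : ℝ} (ha : 0 < a) (hb : 0 < b) :
    volume {y ∈ coordBox (twoSides a b : Fin (k + 2) → ℝ) | y 0 / a + y 1 / b < 1} ≤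
      ENNReal.ofReal (a * b / 2) := by
  set P := {y ∈ coordBox (twoSides a b : Fin (k + 2) → ℝ) | y 0 / a + y 1 / b < 1}
  set v : EuclideanSpace ℝ (Fin (k + 2)) := WithLp.toLp 2 (twoSides a b)
  have hmp := Measure.measurePreserving_sub_left
    (volume : Measure (EuclideanSpace ℝ (Fin (k + 2)))) v
  have hP : MeasurableSet P := by
    have h : IsOpen {y : EuclideanSpace ℝ (Fin (k + 2)) | y 0 / a + y 1 / b < 1} :=
      isOpen_lt (by fun_prop) (by fun_prop)
    exact (isCompact_coordBox _).measurableSet.inter h.measurableSet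
  have hsub : P ∪ (fun y => v - y) ⁻¹' P ⊆ coordBox (twoSides a b) := by
    rintro y (hy | hy)
    · exact hy.1
    · intro i
      have := hy.1 i
      simp only [Set.mem_Icc, PiLp.sub_apply, v] at this
      simp only [Set.mem_Icc]
      constructor <;> linarith
  have hdisj : Disjoint P ((fun y => v - y) ⁻¹' P) := by
    rw [Set.disjoint_left]
    intro y hy hy'
    have h0 : (v - y) 0 = a - y 0 := rfl
    have h1 : (v - y) 1 = b - y 1 := rfl
    have h2 := hy'.2
    simp only [h0, h1, sub_div, div_self ha.ne', div_self hb.ne'] at h2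
    linarith [hy.2]
  have h := measure_mono (μ := volume) hsub
  rw [measure_union' hdisj hP, volume_coordBox_twoSides ha.le hb.le,
    hmp.measure_preimage hP.nullMeasurableSet, ← two_mul] at h
  rw [ENNReal.ofReal_div_of_pos two_pos]
  refine (ENNReal.le_div_iff_mul_le (by simp) (by simp)).2 ?_
  rw [mul_comm]
  simpa using h

/-- The side lengths of the box `[0, a] × [0, w]ᵐ`. -/
def longSides {m : ℕ} (a w : ℝ) : Fin (m + 1) → ℝ :=
  Fin.cons a fun _ => w

theorem longSides_zero {m : ℕ} (a w : ℝ) : (longSides a w : Fin (m + 1) → ℝ) 0 = a := rfl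

theorem longSides_succ {m : ℕ} (a w : ℝ) (i : Fin m) : longSides a w i.succ = w := rfl

theorem longSides_nonneg {m : ℕ} {a w : ℝ} (ha : 0 ≤ a) (hw : 0 ≤ w) (i : Fin (m + 1)) :
    0 ≤ longSides a w i :=
  Fin.cases ha (fun _ => hw) i

theorem prod_longSides {m : ℕ} (a w : ℝ) :
    ∏ i, (longSides a w : Fin (m + 1) → ℝ) i = a * w ^ m := by
  simp [Fin.prod_univ_succ, longSides]

theorem longSides_succ_succAbove {m : ℕ} (a w : ℝ) (i : Fin (m + 1)) (j : Fin (m + 1)) :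
    longSides a w (i.succ.succAbove j) = longSides a w j := by
  refine Fin.cases ?_ (fun j => ?_) j
  · rw [Fin.succ_succAbove_zero]; rfl
  · rw [Fin.succ_succAbove_succ]; rfl

theorem fin_one_succAbove_one (k : ℕ) : (1 : Fin (k + 3)).succAbove 1 = 2 :=
  Fin.succ_succAbove_succ 0 0

theorem fin_two_succAbove_one (k : ℕ) : (2 : Fin (k + 3)).succAbove 1 = 1 :=
  Fin.succ_succAbove_succ 1 0

theorem fin_one_succAbove_zero (k : ℕ) : (1 : Fin (k + 3)).succAbove 0 = 0 :=
  Fin.succ_succAbove_zero 0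

theorem fin_two_succAbove_zero (k : ℕ) : (2 : Fin (k + 3)).succAbove 0 = 0 :=
  Fin.succ_succAbove_zero 1

/-- The box `[0, M] × [0, 1]ᵏ⁺²` with a corner simplex (times a cube) cut off along the
long edge at the origin. -/
def cutBox (k : ℕ) (M e : ℝ) : Set (EuclideanSpace ℝ (Fin (k + 3))) :=
  {x ∈ coordBox (longSides M 1) | e ≤ x 1 + x 2 + e / M * x 0}

theorem isClosed_cutHalfspace (k : ℕ) (M e : ℝ) :
    IsClosed {x : EuclideanSpace ℝ (Fin (k + 3)) | e ≤ x 1 + x 2 + e / M * x 0} :=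
  isClosed_le (by fun_prop) (by fun_prop)

theorem isCompact_cutBox (k : ℕ) (M e : ℝ) : IsCompact (cutBox k M e) :=
  (isCompact_coordBox _).inter_right (isClosed_cutHalfspace k M e)

theorem convex_cutBox (k : ℕ) (M e : ℝ) : Convex ℝ (cutBox k M e) := by
  refine (convex_coordBox _).inter ?_
  intro x hx y hy a b ha hb hab
  have h1 : a * e ≤ a * (x 1 + x 2 + e / M * x 0) := mul_le_mul_of_nonneg_left hx ha
  have h2 : b * e ≤ b * (y 1 + y 2 + e / M * y 0) := mul_le_mul_of_nonneg_left hy hb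
  change e ≤ a * x 1 + b * y 1 + (a * x 2 + b * y 2) + e / M * (a * x 0 + b * y 0)
  calc e = a * e + b * e := by rw [← add_mul, hab, one_mul]
    _ ≤ _ := by linarith

theorem le_volume_cutBox (k : ℕ) {M e : ℝ} (hM : 0 < M) (he : 0 < e) :
    M - e ^ 2 * M ≤ (volume (cutBox k M e)).toReal := by
  set l : Fin (k + 3) → ℝ := Fin.cons M (Fin.cons e (Fin.cons e fun _ => 1)) with hldef
  have hl : ∀ i, 0 ≤ l i := by
    refine Fin.cases hM.le (Fin.cases he.le (Fin.cases he.le fun _ => zero_le_one))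
  have hcov : coordBox (longSides M 1) ⊆ cutBox k M e ∪ coordBox l := by
    intro x hx
    by_cases h : e ≤ x 1 + x 2 + e / M * x 0
    · exact Or.inl ⟨hx, h⟩
    · have h0 := (hx 0).1
      have h1 := (hx 1).1
      have h2 := (hx 2).1
      have h3 : 0 ≤ e / M * x 0 := by positivity
      refine Or.inr (Fin.cases (hx 0) (Fin.cases ⟨h1, ?_⟩ (Fin.cases ⟨h2, ?_⟩ fun i => hx _)))
      · change x 1 ≤ e
        linarith
      · change x 2 ≤ e
        linarith
  have h := (measure_mono hcov).trans (measure_union_le (μ := volume) _ _)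
  have hfin : volume (cutBox k M e) ≠ ⊤ := (isCompact_cutBox k M e).measure_lt_top.ne
  rw [volume_coordBox (longSides_nonneg hM.le zero_le_one), volume_coordBox hl,
    prod_longSides, ← ENNReal.ofReal_toReal hfin,
    ← ENNReal.ofReal_add ENNReal.toReal_nonneg (Finset.prod_nonneg fun i _ => hl i),
    ENNReal.ofReal_le_ofReal_iff
      (add_nonneg ENNReal.toReal_nonneg (Finset.prod_nonneg fun i _ => hl i))] at h
  simp only [hldef, Fin.prod_univ_succ, Fin.cons_zero, Fin.cons_succ, Finset.prod_const_one,
    one_pow] at h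
  linarith

/-- The part of the cut box in a facet adjacent to the cut edge misses a triangular prism. -/
theorem volume_cut_facet_le {k : ℕ} {M e : ℝ} (hM : 0 < M) (he : 0 < e) (he' : e ≤ 1) :
    volume {y ∈ coordBox (longSides M 1 : Fin (k + 2) → ℝ) | e ≤ y 1 + e / M * y 0} ≤
      ENNReal.ofReal (M - 361 / 800 * (e * M)) := by
  set L := {y ∈ coordBox (longSides M 1 : Fin (k + 2) → ℝ) | e ≤ y 1 + e / M * y 0} with hL
  have ha : 0 < 19 / 20 * M := by positivity
  have hb : 0 < 19 / 20 * e := by positivity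
  have hP := le_volume_prism (k := k) ha hb
  set P := {y ∈ coordBox (twoSides (19 / 20 * M) (19 / 20 * e) : Fin (k + 2) → ℝ) |
    y 0 / (19 / 20 * M) + y 1 / (19 / 20 * e) ≤ 1} with hPdef
  have hmeas : MeasurableSet L := by
    have h : IsClosed {y : EuclideanSpace ℝ (Fin (k + 2)) | e ≤ y 1 + e / M * y 0} :=
      isClosed_le (by fun_prop) (by fun_prop)
    exact (isCompact_coordBox _).measurableSet.inter h.measurableSet
  have hdisj : Disjoint L P := by
    rw [Set.disjoint_left]
    rintro y ⟨-, h1⟩ ⟨-, h2⟩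
    have h3 : y 1 + e / M * y 0 =
        19 / 20 * e * (y 0 / (19 / 20 * M) + y 1 / (19 / 20 * e)) := by
      field_simp
      ring
    have h4 := mul_le_mul_of_nonneg_left h2 hb.le
    linarith
  have hsub : L ∪ P ⊆ coordBox (longSides M 1) := by
    refine Set.union_subset (fun y hy => hy.1) fun y hy i => ⟨(hy.1 i).1, ?_⟩
    refine (hy.1 i).2.trans ?_
    refine Fin.cases ?_ (Fin.cases ?_ fun i => ?_) i
    · change 19 / 20 * M ≤ M
      linarith
    · change 19 / 20 * e ≤ 1
      linarith
    · exact le_rfl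
  have h := measure_mono (μ := volume) hsub
  rw [measure_union' hdisj hmeas, volume_coordBox (longSides_nonneg hM.le zero_le_one),
    prod_longSides] at h
  have h' := (add_le_add_right hP (volume L)).trans h
  rw [show M - 361 / 800 * (e * M) = M * 1 ^ (k + 1) -
    19 / 20 * M * (19 / 20 * e) / 2 by ring, ENNReal.ofReal_sub _ (by positivity)]
  exact ENNReal.le_sub_of_add_le_right ENNReal.ofReal_ne_top h'

theorem volume_facet_longSides_zero (m : ℕ) (a : ℝ) :
    volume (coordBox fun j : Fin m =>
      (longSides a 1 : Fin (m + 1) → ℝ) ((0 : Fin (m + 1)).succAbove j)) = 1 := by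
  rw [volume_coordBox]
  · simp [longSides]
  · intro i
    simp [longSides]

theorem volume_facet_longSides_succ {m : ℕ} {a : ℝ} (ha : 0 ≤ a) (i : Fin (m + 1)) :
    volume (coordBox fun j => longSides a 1 (i.succ.succAbove j)) = ENNReal.ofReal a := by
  simp only [longSides_succ_succAbove]
  rw [volume_coordBox (longSides_nonneg ha zero_le_one), prod_longSides, one_pow, mul_one]

/-- A parametrization of the hyperplane `x₁ + x₂ + (e / M) x₀ = e`. -/
noncomputable def cutParam (k : ℕ) (M e : ℝ) (y : EuclideanSpace ℝ (Fin (k + 2))) :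
    EuclideanSpace ℝ (Fin (k + 3)) :=
  WithLp.toLp 2 (Fin.cons (49 / 50 * y 0) (Fin.cons (7 / 10 * y 1)
    (Fin.cons (e - e / M * (49 / 50 * y 0) - 7 / 10 * y 1) fun j : Fin k => y j.succ.succ)))

theorem lipschitzWith_cutParam (k : ℕ) {M e : ℝ} (hM : 0 < M) (he : 0 < e)
    (heM : 100 * e ≤ M) : LipschitzWith 1 (cutParam k M e) := by
  refine LipschitzWith.of_dist_le_mul fun x y => ?_
  rw [EuclideanSpace.dist_eq, EuclideanSpace.dist_eq, NNReal.coe_one, one_mul]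
  refine Real.sqrt_le_sqrt ?_
  simp only [cutParam, Fin.sum_univ_succ, Fin.cons_zero, Fin.cons_succ, Real.dist_eq, sq_abs]
  have hs0 : 0 < e / M := by positivity
  have hs1 : e / M ≤ 1 / 100 := by
    rw [div_le_iff₀ hM]
    linarith
  generalize e / M = s at *
  have key : ∀ u v : ℝ, (49 / 50 * u) ^ 2 + (7 / 10 * v) ^ 2 +
      (s * (49 / 50 * u) + 7 / 10 * v) ^ 2 ≤ u ^ 2 + v ^ 2 := by
    intro u v
    have h1 : s * (2 * u * v) ≤ s * (u ^ 2 + v ^ 2) :=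
      mul_le_mul_of_nonneg_left (two_mul_le_add_sq u v) hs0.le
    have h2 : s * (u ^ 2 + v ^ 2) ≤ 1 / 100 * (u ^ 2 + v ^ 2) :=
      mul_le_mul_of_nonneg_right hs1 (by positivity)
    have h3 : s ^ 2 * u ^ 2 ≤ 1 / 100 * u ^ 2 :=
      mul_le_mul_of_nonneg_right (by nlinarith) (by positivity)
    nlinarith [sq_nonneg u, sq_nonneg v]
  have := key (x 0 - y 0) (x 1 - y 1)
  have e1 : (Fin.succ 0 : Fin (k + 2)) = 1 := rfl
  rw [e1]
  nlinarith [this]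

theorem cutFace_subset (k : ℕ) {M e : ℝ} (hM : 0 < M) (he : 0 < e) :
    {x ∈ cutBox k M e | x 1 + x 2 + e / M * x 0 = e} ⊆ cutParam k M e ''
      {y ∈ coordBox (twoSides (101 / 98 * M) (101 / 70 * e) : Fin (k + 2) → ℝ) |
        y 0 / (101 / 98 * M) + y 1 / (101 / 70 * e) < 1} := by
  rintro x ⟨⟨hx, -⟩, heq⟩
  have h0 : 0 ≤ x 0 ∧ x 0 ≤ M := hx 0
  have h1 := (hx 1).1
  have h2 := (hx 2).1
  have h3 : 0 ≤ e / M * x 0 := mul_nonneg (by positivity) h0.1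
  refine ⟨WithLp.toLp 2 (Fin.cons (50 / 49 * x 0) (Fin.cons (10 / 7 * x 1)
    fun j : Fin k => x j.succ.succ.succ)), ⟨?_, ?_⟩, ?_⟩
  · refine Fin.cases ?_ (Fin.cases ?_ fun i => hx _)
    · change 0 ≤ 50 / 49 * x 0 ∧ 50 / 49 * x 0 ≤ 101 / 98 * M
      constructor <;> linarith
    · change 0 ≤ 10 / 7 * x 1 ∧ 10 / 7 * x 1 ≤ 101 / 70 * e
      constructor <;> linarith
  · change 50 / 49 * x 0 / (101 / 98 * M) + 10 / 7 * x 1 / (101 / 70 * e) < 1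
    have h4 : 50 / 49 * x 0 / (101 / 98 * M) + 10 / 7 * x 1 / (101 / 70 * e) =
        100 / 101 * ((x 1 + e / M * x 0) / e) := by
      field_simp
      ring
    have h5 : (x 1 + e / M * x 0) / e ≤ 1 := by
      rw [div_le_one he]
      linarith
    rw [h4]
    linarith
  · ext i
    refine Fin.cases ?_ (Fin.cases ?_ (Fin.cases ?_ fun i => rfl)) i
    · change 49 / 50 * (50 / 49 * x 0) = x 0
      ring
    · change 7 / 10 * (10 / 7 * x 1) = x 1
      ring
    · change e - e / M * (49 / 50 * (50 / 49 * x 0)) - 7 / 10 * (10 / 7 * x 1) = x 2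
      linarith

theorem frontier_cutBox_subset (k : ℕ) (M e : ℝ) :
    frontier (cutBox k M e) ⊆
      ((⋃ i, hyperplaneEmb i 0 '' (hyperplaneEmb i 0 ⁻¹' cutBox k M e)) ∪
        ⋃ i, hyperplaneEmb i (longSides M 1 i) ''
          coordBox fun j => longSides M 1 (i.succAbove j)) ∪
      {x ∈ cutBox k M e | x 1 + x 2 + e / M * x 0 = e} := by
  intro x hx
  have hxA : x ∈ cutBox k M e := (isCompact_cutBox k M e).isClosed.frontier_subset hx
  by_cases h0 : ∃ i, x i = 0
  · obtain ⟨i, hi⟩ := h0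
    obtain ⟨y, hy, -⟩ := exists_hyperplaneEmb_eq i x
    rw [hi] at hy
    refine Or.inl (Or.inl (Set.mem_iUnion.2 ⟨i, y, ?_, hy⟩))
    rwa [Set.mem_preimage, hy]
  by_cases h1 : ∃ i, x i = longSides M 1 i
  · obtain ⟨i, hi⟩ := h1
    obtain ⟨y, hy, hy'⟩ := exists_hyperplaneEmb_eq i x
    rw [hi] at hy
    refine Or.inl (Or.inr (Set.mem_iUnion.2 ⟨i, y, fun j => ?_, hy⟩))
    rw [hy']
    exact hxA.1 _
  push Not at h0 h1
  refine Or.inr ⟨hxA, ?_⟩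
  by_contra hne
  have hopen : IsOpen ({x : EuclideanSpace ℝ (Fin (k + 3)) |
      ∀ i, x i ∈ Set.Ioo ((fun _ => 0 : Fin (k + 3) → ℝ) i) (longSides M 1 i)} ∩
      {x | e < x 1 + x 2 + e / M * x 0}) :=
    (isOpen_setOf_forall_mem_Ioo _ _).inter (isOpen_lt (by fun_prop) (by fun_prop))
  refine hx.2 (mem_interior.2 ⟨_, ?_, hopen, ?_, ?_⟩)
  · rintro z ⟨hz, hz'⟩
    exact ⟨fun i => ⟨(hz i).1.le, (hz i).2.le⟩, le_of_lt hz'⟩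
  · exact fun i => ⟨(hxA.1 i).1.lt_of_ne' (h0 i), (hxA.1 i).2.lt_of_ne (h1 i)⟩
  · exact lt_of_le_of_ne hxA.2 (Ne.symm hne)

theorem hausdorffMeasure_hyperplaneEmb_image {m : ℕ} (i : Fin (m + 1)) (a : ℝ)
    (s : Set (EuclideanSpace ℝ (Fin m))) :
    μH[(m : ℝ)] (hyperplaneEmb i a '' s) = μH[(m : ℝ)] s :=
  (isometry_hyperplaneEmb i a).hausdorffMeasure_image (Or.inl m.cast_nonneg) s

/-- A bound for the volume of the facet `xᵢ = 0` of the cut box. -/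
noncomputable def lowerFacetBound (k : ℕ) (M e : ℝ) : Fin (k + 3) → ℝ :=
  Fin.cons 1 (Fin.cons (M - 361 / 800 * (e * M)) (Fin.cons (M - 361 / 800 * (e * M)) fun _ => M))

theorem volume_lower_facet_le (k : ℕ) {M e : ℝ} (hM : 0 < M) (he : 0 < e) (he' : e ≤ 1)
    (i : Fin (k + 3)) :
    volume (hyperplaneEmb i 0 ⁻¹' cutBox k M e) ≤ ENNReal.ofReal (lowerFacetBound k M e i) := by
  have hsub : ∀ i : Fin (k + 3), hyperplaneEmb i 0 ⁻¹' cutBox k M e ⊆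
      coordBox fun j => longSides M 1 (i.succAbove j) := by
    intro i y hy j
    have := hy.1 (i.succAbove j)
    rwa [hyperplaneEmb_succAbove] at this
  have hone : ∀ y ∈ hyperplaneEmb 1 0 ⁻¹' cutBox k M e, e ≤ y 1 + e / M * y 0 := by
    intro y hy
    have h := hy.2
    have h2 := hyperplaneEmb_succAbove 1 0 y 1
    have h0 := hyperplaneEmb_succAbove 1 0 y 0
    rw [fin_one_succAbove_one] at h2
    rw [fin_one_succAbove_zero] at h0
    rwa [h0, h2, hyperplaneEmb_same, zero_add] at h
  have htwo : ∀ y ∈ hyperplaneEmb 2 0 ⁻¹' cutBox k M e, e ≤ y 1 + e / M * y 0 := by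
    intro y hy
    have h := hy.2
    have h1 := hyperplaneEmb_succAbove 2 0 y 1
    have h0 := hyperplaneEmb_succAbove 2 0 y 0
    rw [fin_two_succAbove_one] at h1
    rw [fin_two_succAbove_zero] at h0
    rwa [h0, h1, hyperplaneEmb_same, add_zero] at h
  refine Fin.cases ?_ (Fin.cases ?_ (Fin.cases ?_ fun i => ?_)) i
  · refine (measure_mono (hsub 0)).trans ?_
    rw [volume_facet_longSides_zero]
    simp [lowerFacetBound]
  · refine le_trans (measure_mono ?_) (volume_cut_facet_le hM he he')
    refine fun y hy => ⟨fun j => ?_, hone y hy⟩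
    have := hsub _ hy j
    simpa only [longSides_succ_succAbove] using this
  · refine le_trans (measure_mono ?_) (volume_cut_facet_le hM he he')
    refine fun y hy => ⟨fun j => ?_, htwo y hy⟩
    have := hsub _ hy j
    simpa only [longSides_succ_succAbove] using this
  · refine (measure_mono (hsub _)).trans ?_
    rw [volume_facet_longSides_succ hM.le]
    rfl

theorem hausdorffMeasure_frontier_cutBox_le (k : ℕ) {M e c : ℝ} (he : 0 < e)
    (he' : e ≤ 1) (heM : 100 * e ≤ M) (hc : 0 < c)
    (hμ : ∀ s : Set (EuclideanSpace ℝ (Fin (k + 2))),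
      μH[((k + 2 : ℕ) : ℝ)] s = ENNReal.ofReal c * volume s) :
    μH[((k + 2 : ℕ) : ℝ)] (frontier (cutBox k M e)) ≤
      ENNReal.ofReal (c * (2 + 2 * (k + 2) * M - 3 / 20 * (e * M))) := by
  have hM : 0 < M := by linarith
  have heM0 : 0 < e * M := mul_pos he hM
  have heM1 : e * M ≤ M := mul_le_of_le_one_left hM.le he'
  have hnn : ∀ i, 0 ≤ lowerFacetBound k M e i :=
    Fin.cases zero_le_one (Fin.cases (by change 0 ≤ M - 361 / 800 * (e * M); linarith)
      (Fin.cases (by change 0 ≤ M - 361 / 800 * (e * M); linarith) fun _ => hM.le))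
  have hlow : ∑ i : Fin (k + 3), volume (hyperplaneEmb i 0 ⁻¹' cutBox k M e) ≤
      ENNReal.ofReal (1 + 2 * (M - 361 / 800 * (e * M)) + k * M) := by
    refine (Finset.sum_le_sum fun i _ => volume_lower_facet_le k hM he he' i).trans ?_
    rw [← ENNReal.ofReal_sum_of_nonneg fun i _ => hnn i]
    refine ENNReal.ofReal_le_ofReal (le_of_eq ?_)
    simp only [lowerFacetBound, Fin.sum_univ_succ, Fin.cons_zero, Fin.cons_succ,
      Finset.sum_const, Finset.card_univ, Fintype.card_fin, nsmul_eq_mul]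
    ring
  have hup : ∑ i : Fin (k + 3), volume (coordBox fun j =>
      (longSides M 1 : Fin (k + 3) → ℝ) (i.succAbove j)) = ENNReal.ofReal (1 + (k + 2) * M) := by
    rw [Fin.sum_univ_succ, volume_facet_longSides_zero]
    simp only [volume_facet_longSides_succ hM.le, Finset.sum_const, Finset.card_univ,
      Fintype.card_fin, nsmul_eq_mul]
    rw [ENNReal.ofReal_add zero_le_one (by positivity), ENNReal.ofReal_mul (by positivity),
      ENNReal.ofReal_one]
    congr 2
    rw [← ENNReal.ofReal_natCast]
    push_cast
    rfl
  have hcut : μH[((k + 2 : ℕ) : ℝ)] {x ∈ cutBox k M e | x 1 + x 2 + e / M * x 0 = e} ≤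
      ENNReal.ofReal c * ENNReal.ofReal (101 / 98 * M * (101 / 70 * e) / 2) := by
    refine (measure_mono (cutFace_subset k hM he)).trans ?_
    refine ((lipschitzWith_cutParam k hM he heM).hausdorffMeasure_image_le
      (Nat.cast_nonneg _) _).trans ?_
    rw [ENNReal.coe_one, ENNReal.one_rpow, one_mul, hμ]
    gcongr
    exact volume_prism_le (by positivity) (by positivity)
  refine (measure_mono (frontier_cutBox_subset k M e)).trans ?_
  refine (measure_union_le _ _).trans ?_
  refine (add_le_add ((measure_union_le _ _).trans
    (add_le_add (measure_iUnion_fintype_le _ _) (measure_iUnion_fintype_le _ _))) hcut).trans ?_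
  simp only [hausdorffMeasure_hyperplaneEmb_image, hμ, ← Finset.mul_sum]
  rw [hup, ← mul_add, ← mul_add]
  refine (mul_le_mul_right (add_le_add_left (add_le_add_left hlow _) _) _).trans ?_
  have hk : (0 : ℝ) ≤ k := k.cast_nonneg
  have hkM : 0 ≤ k * M := by positivity
  rw [← ENNReal.ofReal_add (by linarith) (by positivity),
    ← ENNReal.ofReal_add (by nlinarith) (by positivity), ← ENNReal.ofReal_mul hc.le]
  refine ENNReal.ofReal_le_ofReal (mul_le_mul_of_nonneg_left ?_ hc.le)
  linarith

/-- A facet of a closed set lying in a halfspace belongs to its frontier. -/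
theorem mem_frontier_of_forall_le {m : ℕ} {K : Set (EuclideanSpace ℝ (Fin m))} (i : Fin m)
    {x : EuclideanSpace ℝ (Fin m)} (hx : x ∈ K) (h : ∀ z ∈ K, z i ≤ x i) : x ∈ frontier K := by
  refine ⟨subset_closure hx, fun hint => ?_⟩
  have hmax : IsLocalMax (fun z : EuclideanSpace ℝ (Fin m) => EuclideanSpace.proj (𝕜 := ℝ) i z) x :=
    Filter.mem_of_superset (mem_interior_iff_mem_nhds.1 hint) fun z hz => h z hz
  have h0 := hmax.hasFDerivAt_eq_zero (EuclideanSpace.proj (𝕜 := ℝ) i).hasFDerivAt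
  have h1 := congrArg (fun f => f (EuclideanSpace.single i (1 : ℝ))) h0
  simp at h1

theorem mem_frontier_of_forall_ge {m : ℕ} {K : Set (EuclideanSpace ℝ (Fin m))} (i : Fin m)
    {x : EuclideanSpace ℝ (Fin m)} (hx : x ∈ K) (h : ∀ z ∈ K, x i ≤ z i) : x ∈ frontier K := by
  refine ⟨subset_closure hx, fun hint => ?_⟩
  have hmin : IsLocalMin (fun z : EuclideanSpace ℝ (Fin m) => EuclideanSpace.proj (𝕜 := ℝ) i z) x :=
    Filter.mem_of_superset (mem_interior_iff_mem_nhds.1 hint) fun z hz => h z hz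
  have h0 := hmin.hasFDerivAt_eq_zero (EuclideanSpace.proj (𝕜 := ℝ) i).hasFDerivAt
  have h1 := congrArg (fun f => f (EuclideanSpace.single i (1 : ℝ))) h0
  simp at h1

/-- The surface area of a body that fills the upper part `[a, b] × [0, w]ᵐ` of a
box `[0, b] × [0, w]ᵐ` is at least the lateral area of that part. -/
theorem le_hausdorffMeasure_frontier {m : ℕ} {a b w c : ℝ} (hab : a ≤ b) (hw : 0 < w)
    (hc : 0 < c) (hμ : ∀ s : Set (EuclideanSpace ℝ (Fin (m + 1))),
      μH[((m + 1 : ℕ) : ℝ)] s = ENNReal.ofReal c * volume s)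
    {K : Set (EuclideanSpace ℝ (Fin (m + 2)))} (hK : K ⊆ coordBox (longSides b w))
    (hK' : ∀ x ∈ coordBox (longSides b w), a ≤ x 0 → x ∈ K) (ha : 0 ≤ a) :
    ENNReal.ofReal (c * (2 * (m + 1) * ((b - a) * w ^ m))) ≤
      μH[((m + 1 : ℕ) : ℝ)] (frontier K) := by
  set S : Set (EuclideanSpace ℝ (Fin (m + 1))) :=
    {y | ∀ j, y j ∈ Set.Ioo (longSides a 0 j) (longSides b w j)} with hS
  have hSvol : volume S = ENNReal.ofReal ((b - a) * w ^ m) := by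
    rw [hS, volume_setOf_forall_mem_Ioo (Fin.cases hab fun _ => hw.le), Fin.prod_univ_succ]
    simp [longSides]
  let v : Bool → ℝ := fun t => if t then w else 0
  let F : Fin (m + 1) × Bool → Set (EuclideanSpace ℝ (Fin (m + 2))) :=
    fun p => hyperplaneEmb p.1.succ (v p.2) '' S
  have hsub : (⋃ p, F p) ⊆ frontier K := by
    refine Set.iUnion_subset ?_
    rintro ⟨i, t⟩ _ ⟨y, hy, rfl⟩
    set x := hyperplaneEmb i.succ (v t) y with hx
    have hxi : x i.succ = v t := hyperplaneEmb_same _ _ _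
    have hx0 : x 0 = y 0 := by
      have := hyperplaneEmb_succAbove i.succ (v t) y 0
      rwa [Fin.succ_succAbove_zero] at this
    have hxK : x ∈ K := by
      refine hK' x (fun j => ?_) ?_
      · refine Fin.succAboveCases i.succ ?_ (fun j => ?_) j
        · rw [hxi, longSides_succ]
          cases t <;> simp [v, hw.le]
        · rw [hx, hyperplaneEmb_succAbove, longSides_succ_succAbove]
          refine ⟨le_trans ?_ (hy j).1.le, (hy j).2.le⟩
          exact longSides_nonneg ha le_rfl j
      · rw [hx0]
        exact (hy 0).1.le
    cases t
    · exact mem_frontier_of_forall_ge i.succ hxK fun z hz => hxi.trans_le (hK hz _).1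
    · exact mem_frontier_of_forall_le i.succ hxK fun z hz => (hK hz _).2.trans_eq hxi.symm
  have hmeas : ∀ p, MeasurableSet (F p) := fun p =>
    (isometry_hyperplaneEmb _ _).isClosedEmbedding.measurableEmbedding.measurableSet_image.2
      (isOpen_setOf_forall_mem_Ioo _ _).measurableSet
  have hdisj : Pairwise (Function.onFun Disjoint F) := by
    rintro ⟨i, t⟩ ⟨j, u⟩ hne
    refine Set.disjoint_left.2 ?_
    rintro x ⟨y, hy, rfl⟩ ⟨z, hz, hzy⟩
    have h1 : hyperplaneEmb i.succ (v t) y i.succ = v t := hyperplaneEmb_same _ _ _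
    by_cases hij : i = j
    · subst hij
      have h2 : hyperplaneEmb i.succ (v u) z i.succ = v u := hyperplaneEmb_same _ _ _
      rw [hzy, h1] at h2
      refine hne (Prod.ext rfl ?_)
      cases t <;> cases u <;> simp [v, hw.ne, hw.ne'] at h2 ⊢
    · obtain ⟨l, hl⟩ := Fin.exists_succAbove_eq (show i.succ ≠ j.succ by simpa using hij)
      have h2 : hyperplaneEmb j.succ (v u) z i.succ = z l := by
        rw [← hl, hyperplaneEmb_succAbove]
      have hl0 : l ≠ 0 := by
        rintro rfl
        rw [Fin.succ_succAbove_zero] at hl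
        exact Fin.succ_ne_zero i hl.symm
      obtain ⟨l', rfl⟩ := Fin.exists_succ_eq.2 hl0
      have h3 := hz l'.succ
      rw [← h2, hzy, h1, longSides_succ, longSides_succ] at h3
      cases t <;> simp [v] at h3
  refine le_trans (le_of_eq ?_) (measure_mono hsub)
  rw [measure_iUnion hdisj hmeas, tsum_fintype]
  simp only [F, hausdorffMeasure_hyperplaneEmb_image, hμ, hSvol, Finset.sum_const,
    Finset.card_univ, Fintype.card_prod, Fintype.card_fin, Fintype.card_bool, nsmul_eq_mul]
  rw [ENNReal.ofReal_mul hc.le, ENNReal.ofReal_mul (by positivity), mul_left_comm]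
  congr 2
  rw [← ENNReal.ofReal_natCast]
  push_cast
  rw [mul_comm]

theorem interior_coordBox_nonempty {m : ℕ} {l : Fin m → ℝ} (hl : ∀ i, 0 < l i) :
    (interior (coordBox l)).Nonempty := by
  refine ⟨WithLp.toLp 2 fun i => l i / 2, mem_interior.2
    ⟨{x | ∀ i, x i ∈ Set.Ioo ((fun _ => 0 : Fin m → ℝ) i) (l i)}, fun x hx i => ?_,
      isOpen_setOf_forall_mem_Ioo _ _, fun i => ?_⟩⟩
  · exact ⟨(hx i).1.le, (hx i).2.le⟩
  · have := hl i
    change 0 < l i / 2 ∧ l i / 2 < l i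
    constructor <;> linarith

theorem interior_cutBox_nonempty (k : ℕ) {M e : ℝ} (hM : 0 < M) (he : 0 < e) (he' : e < 1) :
    (interior (cutBox k M e)).Nonempty := by
  have hopen : IsOpen ({x : EuclideanSpace ℝ (Fin (k + 3)) |
      ∀ i, x i ∈ Set.Ioo ((fun _ => 0 : Fin (k + 3) → ℝ) i) (longSides M 1 i)} ∩
      {x | e < x 1 + x 2 + e / M * x 0}) :=
    (isOpen_setOf_forall_mem_Ioo _ _).inter (isOpen_lt (by fun_prop) (by fun_prop))
  refine ⟨WithLp.toLp 2 fun i => longSides M 1 i / 2, mem_interior.2 ⟨_, ?_, hopen, ?_, ?_⟩⟩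
  · rintro z ⟨hz, hz'⟩
    exact ⟨fun i => ⟨(hz i).1.le, (hz i).2.le⟩, le_of_lt hz'⟩
  · intro i
    have : (0 : ℝ) < longSides M 1 i := Fin.cases hM (fun _ => one_pos) i
    change 0 < longSides M 1 i / 2 ∧ longSides M 1 i / 2 < longSides M 1 i
    constructor <;> linarith
  · change e < 1 / 2 + 1 / 2 + e / M * (M / 2)
    have : 0 < e / M * (M / 2) := by positivity
    linarith

theorem hausdorffMeasure_frontier_cutBox_ne_zero (k : ℕ) {M e c : ℝ} (hM : 0 < M) (he : 0 < e)
    (he' : e ≤ 1) (hc : 0 < c)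
    (hμ : ∀ s : Set (EuclideanSpace ℝ (Fin (k + 2))),
      μH[((k + 2 : ℕ) : ℝ)] s = ENNReal.ofReal c * volume s) :
    μH[((k + 2 : ℕ) : ℝ)] (frontier (cutBox k M e)) ≠ 0 := by
  have hsub : hyperplaneEmb 1 1 '' coordBox (longSides M 1) ⊆ frontier (cutBox k M e) := by
    rintro _ ⟨y, hy, rfl⟩
    set x := hyperplaneEmb 1 1 y with hx
    have hx1 : x 1 = 1 := hyperplaneEmb_same _ _ _
    have hxB : x ∈ coordBox (longSides M 1) := by
      refine fun j => Fin.succAboveCases 1 ?_ (fun j => ?_) j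
      · rw [hx1]
        exact ⟨zero_le_one, le_rfl⟩
      · rw [hx, hyperplaneEmb_succAbove]
        have : longSides M 1 ((1 : Fin (k + 3)).succAbove j) = longSides M 1 j :=
          longSides_succ_succAbove M 1 0 j
        rw [this]
        exact hy j
    have hxA : x ∈ cutBox k M e := by
      refine ⟨hxB, ?_⟩
      have h2 := (hxB 2).1
      have h0 : 0 ≤ e / M * x 0 := mul_nonneg (by positivity) (hxB 0).1
      change e ≤ x 1 + x 2 + e / M * x 0
      linarith
    exact mem_frontier_of_forall_le 1 hxA fun z hz => (hz.1 1).2.trans_eq hx1.symm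
  refine fun h => absurd (measure_mono_null hsub h) ?_
  rw [hausdorffMeasure_hyperplaneEmb_image, hμ,
    volume_coordBox (longSides_nonneg hM.le zero_le_one), prod_longSides, one_pow, mul_one,
    ← ENNReal.ofReal_mul hc.le]
  simpa using mul_pos hc hM

theorem cutBox_add_coordBox_subset (k : ℕ) (M e L d : ℝ) :
    cutBox k M e + coordBox (longSides L d) ⊆ coordBox (longSides (M + L) (1 + d)) := by
  rintro _ ⟨x, hx, y, hy, rfl⟩ i
  have h1 := hx.1 i
  have h2 := hy i
  refine ⟨add_nonneg h1.1 h2.1, (add_le_add h1.2 h2.2).trans_eq ?_⟩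
  exact Fin.cases rfl (fun _ => rfl) i

theorem mem_cutBox_add_coordBox (k : ℕ) {M e L d : ℝ} (hM : 0 < M) (hd : 0 < d)
    {x : EuclideanSpace ℝ (Fin (k + 3))} (hx : x ∈ coordBox (longSides (M + L) (1 + d)))
    (hx0 : M ≤ x 0) : x ∈ cutBox k M e + coordBox (longSides L d) := by
  have hsucc : ∀ i : Fin (k + 2), 0 ≤ x i.succ / (1 + d) ∧ x i.succ / (1 + d) ≤ 1 := by
    intro i
    have h := hx i.succ
    exact ⟨div_nonneg h.1 (by positivity), (div_le_one (by positivity)).2 h.2⟩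
  refine ⟨WithLp.toLp 2 (Fin.cons M fun i => x i.succ / (1 + d)), ⟨?_, ?_⟩,
    WithLp.toLp 2 (Fin.cons (x 0 - M) fun i => d * (x i.succ / (1 + d))), ?_, ?_⟩
  · exact Fin.cases ⟨hM.le, le_rfl⟩ hsucc
  · have h1 := (hsucc 0).1
    have h2 := (hsucc 1).1
    change e ≤ x (Fin.succ 0) / (1 + d) + x (Fin.succ 1) / (1 + d) + e / M * M
    rw [div_mul_cancel₀ _ hM.ne']
    linarith
  · refine Fin.cases ⟨sub_nonneg.2 hx0, ?_⟩ fun i => ⟨mul_nonneg hd.le (hsucc i).1, ?_⟩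
    · have h := (hx 0).2
      rw [longSides_zero] at h
      change x 0 - M ≤ L
      linarith
    · exact mul_le_of_le_one_right hd.le (hsucc i).2
  · ext i
    refine Fin.cases ?_ (fun i => ?_) i
    · change M + (x 0 - M) = x 0
      ring
    · change x i.succ / (1 + d) + d * (x i.succ / (1 + d)) = x i.succ
      field_simp

/-- Lower bound for the information functional of the cut box. -/
theorem le_info_cutBox (k : ℕ) {M e c : ℝ} (he : 0 < e) (he' : e ≤ 1) (heM : 100 * e ≤ M)
    (hc : 0 < c)
    (hμ : ∀ s : Set (EuclideanSpace ℝ (Fin (k + 2))),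
      μH[((k + 2 : ℕ) : ℝ)] s = ENNReal.ofReal c * volume s) :
    (M - e ^ 2 * M) / (c * (2 + 2 * (k + 2) * M - 3 / 20 * (e * M))) ≤
      info (k + 3) (cutBox k M e) := by
  have hM : 0 < M := by linarith
  have hdim : (((k + 3 : ℕ) : ℝ)) - 1 = ((k + 2 : ℕ) : ℝ) := by push_cast; ring
  have hle := hausdorffMeasure_frontier_cutBox_le k he he' heM hc hμ
  have hne := hausdorffMeasure_frontier_cutBox_ne_zero k hM he he' hc hμ
  have hpos := ENNReal.toReal_pos hne (ne_top_of_le_ne_top ENNReal.ofReal_ne_top hle)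
  have hS : 0 ≤ c * (2 + 2 * (k + 2) * M - 3 / 20 * (e * M)) := by
    have h1 : e * M ≤ M := mul_le_of_le_one_left hM.le he'
    have h2 : 0 ≤ k * M := by positivity
    refine mul_nonneg hc.le ?_
    linarith
  rw [info, hdim]
  exact div_le_div₀ ENNReal.toReal_nonneg (le_volume_cutBox k hM he) hpos
    (ENNReal.toReal_le_of_le_ofReal hS hle)

/-- Upper bound for the information functional of the cut box plus a long thin box. -/
theorem info_cutBox_add_coordBox_le (k : ℕ) {M e c L d : ℝ} (hM : 0 < M)
    (hL : 0 < L) (hd : 0 < d) (hc : 0 < c)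
    (hμ : ∀ s : Set (EuclideanSpace ℝ (Fin (k + 2))),
      μH[((k + 2 : ℕ) : ℝ)] s = ENNReal.ofReal c * volume s) :
    info (k + 3) (cutBox k M e + coordBox (longSides L d)) ≤
      (M + L) * (1 + d) / (c * (2 * (k + 2) * L)) := by
  have hdim : (((k + 3 : ℕ) : ℝ)) - 1 = ((k + 2 : ℕ) : ℝ) := by push_cast; ring
  rw [info, hdim]
  by_cases htop : μH[((k + 2 : ℕ) : ℝ)]
      (frontier (cutBox k M e + coordBox (longSides L d))) = ⊤
  · rw [htop, ENNReal.toReal_top, div_zero]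
    positivity
  have hw : 0 < 1 + d := by linarith
  have hS := le_hausdorffMeasure_frontier (by linarith : M ≤ M + L) hw hc hμ
    (cutBox_add_coordBox_subset k M e L d)
    (fun x hx hx0 => mem_cutBox_add_coordBox k hM hd hx hx0) hM.le
  have hV := measure_mono (μ := volume) (cutBox_add_coordBox_subset k M e L d)
  rw [volume_coordBox (longSides_nonneg (by linarith) hw.le), prod_longSides] at hV
  have hV' := ENNReal.toReal_le_of_le_ofReal (by positivity) hV
  have hS' := (ENNReal.ofReal_le_iff_le_toReal htop).1 hS
  refine (div_le_div₀ (by positivity) hV' (by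
    rw [add_sub_cancel_left]; positivity) hS').trans_eq ?_
  have hpow : (1 + d) ^ (k + 1) ≠ 0 := by positivity
  rw [add_sub_cancel_left, pow_succ (1 + d) (k + 1)]
  push_cast
  field_simp
  ring

/-- In dimension `n ≥ 3` the information functional is not monotone with respect to
Minkowski addition: there are convex bodies `A`, `T` with `I(A+T) < I(A)`. -/
theorem info_not_monotone {n : ℕ} (hn : 3 ≤ n) :
    ∃ A T : Set (EuclideanSpace ℝ (Fin n)),
      Convex ℝ A ∧ IsCompact A ∧ (interior A).Nonempty ∧
      Convex ℝ T ∧ IsCompact T ∧ (interior T).Nonempty ∧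
      info n (A + T) < info n A := by
  obtain ⟨k, rfl⟩ := Nat.exists_eq_add_of_le' hn
  obtain ⟨c, hc, hμ⟩ := exists_hausdorffMeasure_eq_mul_volume (k + 2)
  obtain ⟨p, hp⟩ : ∃ p : ℝ, p = k + 2 := ⟨_, rfl⟩
  have hp2 : 2 ≤ p := by
    rw [hp]
    linarith [(k.cast_nonneg : (0 : ℝ) ≤ k)]
  have hp0 : 0 < p := by linarith
  obtain ⟨M, hM⟩ : ∃ M : ℝ, M = 1000 * p := ⟨_, rfl⟩
  obtain ⟨e, he⟩ : ∃ e : ℝ, e = 1 / (20 * p) := ⟨_, rfl⟩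
  obtain ⟨d, hd⟩ : ∃ d : ℝ, d = 1 / (8 * (2 * p * M)) := ⟨_, rfl⟩
  have hM0 : 0 < M := by rw [hM]; positivity
  have he0 : 0 < e := by rw [he]; positivity
  have hd0 : 0 < d := by rw [hd]; positivity
  have he1 : e < 1 := by
    rw [he, div_lt_one (by positivity)]
    linarith
  have heM : e * M = 50 := by
    rw [he, hM]
    field_simp
    norm_num
  have hep : e * p = 1 / 20 := by
    rw [he]
    field_simp
  have hL0 : 0 < M / d := by positivity
  refine ⟨cutBox k M e, coordBox (longSides (M / d) d), convex_cutBox k M e,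
    isCompact_cutBox k M e, interior_cutBox_nonempty k hM0 he0 he1, convex_coordBox _,
    isCompact_coordBox _, interior_coordBox_nonempty (Fin.cases hL0 fun _ => hd0), ?_⟩
  refine (info_cutBox_add_coordBox_le k hM0 hL0 hd0 hc hμ).trans_lt
    (lt_of_lt_of_le ?_ (le_info_cutBox k he0 he1.le (by linarith) hc hμ))
  rw [← hp]
  have hpM : 4000 ≤ 2 * p * M := by
    rw [hM]
    nlinarith
  have hN : d * (2 * p * M) = 1 / 8 := by
    rw [hd]
    field_simp
  have h1 : (M + M / d) * (1 + d) / (c * (2 * p * (M / d))) = (1 + d) ^ 2 / (c * (2 * p)) := by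
    field_simp
    ring
  have h2 : M - e ^ 2 * M = (2 * p * M - 5) / (2 * p) := by
    have : e ^ 2 * M * p = 5 / 2 := by
      calc e ^ 2 * M * p = (e * M) * (e * p) := by ring
        _ = 5 / 2 := by rw [heM, hep]; norm_num
    field_simp
    linarith
  have hd1 : d ≤ 1 := by nlinarith
  rw [h1, h2, heM, div_div, div_lt_div_iff₀ (by positivity)
    (mul_pos (by positivity) (mul_pos hc (by linarith)))]
  have h3 : (1 + d) ^ 2 * (2 + 2 * p * M - 3 / 20 * 50) < 2 * p * M - 5 := by
    generalize 2 * p * M = N at *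
    nlinarith
  calc (1 + d) ^ 2 * (2 * p * (c * (2 + 2 * p * M - 3 / 20 * 50)))
      = 2 * p * c * ((1 + d) ^ 2 * (2 + 2 * p * M - 3 / 20 * 50)) := by ring
    _ < 2 * p * c * (2 * p * M - 5) := mul_lt_mul_of_pos_left h3 (by positivity)
    _ = (2 * p * M - 5) * (c * (2 * p)) := by ring
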